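/- Let G be a d-regular simple graph that contains no cycle of length 4 (as a subgraph). For an edge {u, v} of G, let max_{u,v} denote the maximum number of 5-cycles of G such that the intersection of any two different ones of them is exactly the edge {u, v}; for a path P of length two in G, let max_P denote the maximum number of 5-cycles of G such that the intersection of any two different ones of them is exactly the path P. If there exists a vertex v of G such that for every edge {u, v} incident with v one has max_{u,v} ≤ (d-2)/2, and for every path P of length two one has max_P ≤ (d-2)/2, then φ(G) = d + 1. -/

import Mathlib

open SimpleGraph

/-- A b-coloring of `G` with `k` colors: a proper coloring using all `k` colors in which
every color class contains a vertex adjacent to at least one vertex of each other color class. -/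
def IsBColoring {V : Type*} (G : SimpleGraph V) (k : ℕ) (C : V → Fin k) : Prop :=
  (∀ u v : V, G.Adj u v → C u ≠ C v) ∧
  ∀ c : Fin k, ∃ v : V, C v = c ∧ ∀ c' : Fin k, c' ≠ c → ∃ u : V, G.Adj v u ∧ C u = c'

/-- The b-chromatic number: the largest `k` such that `G` admits a b-coloring with `k` colors. -/
noncomputable def bChromaticNumber {V : Type*} (G : SimpleGraph V) : ℕ :=
  sSup {k : ℕ | ∃ C : V → Fin k, IsBColoring G k C}

/-- `G` contains no cycle of length 4. -/
def NoFourCycle {V : Type*} (G : SimpleGraph V) : Prop :=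
  ∀ (v : V) (w : G.Walk v v), w.IsCycle → w.length ≠ 4

/-- `C` is a 5-cycle of `G`, represented as the subgraph of some cycle walk of length 5. -/
def IsFiveCycle {V : Type*} (G : SimpleGraph V) (C : G.Subgraph) : Prop :=
  ∃ (a : V) (w : G.Walk a a), w.IsCycle ∧ w.length = 5 ∧ C = w.toSubgraph

/-- `P` is a path of length two of `G`, represented as the subgraph of a path walk of length 2. -/
def IsTwoPath {V : Type*} (G : SimpleGraph V) (P : G.Subgraph) : Prop :=
  ∃ (a b : V) (w : G.Walk a b), w.IsPath ∧ w.length = 2 ∧ P = w.toSubgraph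

/-- The maximum number of 5-cycles of `G` such that the intersection of any two different
ones of them is exactly the subgraph `P`. -/
noncomputable def maxFiveCyclesInter {V : Type*} (G : SimpleGraph V) (P : G.Subgraph) : ℕ :=
  sSup {n : ℕ | ∃ S : Set G.Subgraph, S.ncard = n ∧ (∀ C ∈ S, IsFiveCycle G C) ∧
    ∀ C₁ ∈ S, ∀ C₂ ∈ S, C₁ ≠ C₂ → C₁ ⊓ C₂ = P}

section Aux
variable {V : Type*}

lemma noFour_eq {G : SimpleGraph V} (h4 : NoFourCycle G) {a b c e : V}
    (h1 : G.Adj a b) (h2 : G.Adj b c) (h3 : G.Adj c e) (h5 : G.Adj e a) (hac : a ≠ c) : b = e := by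
  by_contra hbe
  refine h4 a (Walk.cons h1 (Walk.cons h2 (Walk.cons h3 (Walk.cons h5 Walk.nil)))) ?_ (by simp)
  have := h1.ne; have := h2.ne; have := h3.ne; have := h5.ne
  rw [Walk.isCycle_def]
  refine ⟨?_, by simp, ?_⟩
  · rw [Walk.isTrail_def]
    simp
    grind
  · simp
    grind

/-- The 5-cycle through five given vertices. -/
def fiveWalk {G : SimpleGraph V} {v u x y w : V} (h1 : G.Adj v u) (h2 : G.Adj u x)
    (h3 : G.Adj x y) (h5 : G.Adj y w) (h6 : G.Adj w v) : G.Walk v v :=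
  Walk.cons h1 (Walk.cons h2 (Walk.cons h3 (Walk.cons h5 (Walk.cons h6 Walk.nil))))

lemma fiveWalk_isFive {G : SimpleGraph V} {v u x y w : V} (h1 : G.Adj v u) (h2 : G.Adj u x)
    (h3 : G.Adj x y) (h5 : G.Adj y w) (h6 : G.Adj w v)
    (a1 : v ≠ x) (a2 : v ≠ y) (a3 : u ≠ y) (a4 : u ≠ w) (a5 : x ≠ w) :
    IsFiveCycle G (fiveWalk h1 h2 h3 h5 h6).toSubgraph := by
  refine ⟨v, fiveWalk h1 h2 h3 h5 h6, ?_, by simp [fiveWalk], rfl⟩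
  have := h1.ne; have := h2.ne; have := h3.ne; have := h5.ne; have := h6.ne
  rw [Walk.isCycle_def]
  refine ⟨?_, by simp [fiveWalk], ?_⟩
  · rw [Walk.isTrail_def]
    simp [fiveWalk]
    grind
  · simp [fiveWalk]
    grind

lemma le_maxFive [Fintype V] {G : SimpleGraph V} (P : G.Subgraph) {ι : Type*} (T : Finset ι)
    (C : ι → G.Subgraph) (hinj : Set.InjOn C T) (h5 : ∀ i ∈ T, IsFiveCycle G (C i))
    (hint : ∀ i ∈ T, ∀ j ∈ T, i ≠ j → C i ⊓ C j = P) : T.card ≤ maxFiveCyclesInter G P := by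
  classical
  apply le_csSup
  · refine ⟨Nat.card G.Subgraph, ?_⟩
    rintro n ⟨S, rfl, -⟩
    exact Set.ncard_le_card S
  · refine ⟨Set.image C T, ?_, ?_, ?_⟩
    · rw [hinj.ncard_image, Set.ncard_coe_finset]
    · rintro _ ⟨i, hi, rfl⟩
      exact h5 i hi
    · rintro _ ⟨i, hi, rfl⟩ _ ⟨j, hj, rfl⟩ hne
      exact hint i hi j hj (fun h => hne (by rw [h]))

/-- Vertices below `u` in the second level from `v`. -/
def InA (G : SimpleGraph V) (v u x : V) : Prop := G.Adj u x ∧ x ≠ v ∧ ¬ G.Adj v x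

lemma InA.unique {G : SimpleGraph V} (h4 : NoFourCycle G) {v u w x : V} (hu : G.Adj v u)
    (hw : G.Adj v w) (h1 : InA G v u x) (h2 : InA G v w x) : u = w :=
  noFour_eq h4 hu h1.1 h2.1.symm hw.symm h1.2.1.symm

lemma bound_path [Fintype V] {G : SimpleGraph V} (h4 : NoFourCycle G) {v u x : V} {d : ℕ}
    (hpath : ∀ P : G.Subgraph, IsTwoPath G P →
      ((maxFiveCyclesInter G P : ℝ)) ≤ ((d : ℝ) - 2) / 2)
    (hu : G.Adj v u) (hx : InA G v u x) (Y : Finset V)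
    (hY : ∀ y ∈ Y, G.Adj x y ∧ ∃ w, w ≠ u ∧ G.Adj v w ∧ InA G v w y) :
    2 * Y.card + 2 ≤ d := by
  classical
  let P : G.Subgraph := (Walk.cons hu (Walk.cons hx.1 Walk.nil)).toSubgraph
  have hP : IsTwoPath G P := by
    refine ⟨v, x, _, ?_, by simp, rfl⟩
    have := hu.ne; have := hx.1.ne; have := hx.2.1
    rw [Walk.isPath_def]
    simp
    grind
  have hm := hpath P hP
  suffices h : Y.card ≤ maxFiveCyclesInter G P by
    have : (Y.card : ℝ) ≤ maxFiveCyclesInter G P := by exact_mod_cast h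
    have : (2 * Y.card + 2 : ℝ) ≤ d := by linarith
    exact_mod_cast this
  choose! hxy w hwu hvw hA using hY
  let C : V → G.Subgraph := fun y => if h : y ∈ Y then
    (fiveWalk hu hx.1 (hxy y h) (hA y h).1.symm (hvw y h).symm).toSubgraph else ⊥
  have hC : ∀ y (h : y ∈ Y), C y =
    (fiveWalk hu hx.1 (hxy y h) (hA y h).1.symm (hvw y h).symm).toSubgraph := by
    intro y h; simp [C, h]
  have hwinj : ∀ y ∈ Y, ∀ z ∈ Y, y ≠ z → w y ≠ w z := by
    intro y hy z hz hyz he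
    apply hyz
    refine noFour_eq h4 (hxy y hy) (hA y hy).1.symm (he ▸ (hA z hz).1) (hxy z hz).symm ?_
    rintro h
    exact hx.2.2 (h ▸ hvw y hy)
  have hint : ∀ y ∈ Y, ∀ z ∈ Y, y ≠ z → C y ⊓ C z = P := by
    intro y hy z hz hyz
    rw [hC y hy, hC z hz]
    have e1 := hwinj y hy z hz hyz
    have e2 : y ≠ w z := fun h => (hA y hy).2.2 (h ▸ hvw z hz)
    have e3 : z ≠ w y := fun h => (hA z hz).2.2 (h ▸ hvw y hy)
    have := hu.ne; have := hx.1.ne; have := hx.2.1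
    have := (hxy y hy).ne; have := (hxy z hz).ne
    have := (hA y hy).1.ne; have := (hA z hz).1.ne
    have := (hvw y hy).ne; have := (hvw z hz).ne
    have := (hA y hy).2.1; have := (hA z hz).2.1
    have := hwu y hy; have := hwu z hz
    have : u ≠ y := fun h => (hA y hy).2.2 (h ▸ hu)
    have : u ≠ z := fun h => (hA z hz).2.2 (h ▸ hu)
    have : x ≠ w y := fun h => hx.2.2 (h ▸ hvw y hy)
    have : x ≠ w z := fun h => hx.2.2 (h ▸ hvw z hz)
    ext a b
    · simp [fiveWalk, P]
      grind
    · simp [fiveWalk, P]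
      grind
  have hinj : Set.InjOn C Y := by
    intro y hy z hz he
    by_contra hyz
    have h1 := hint y hy z hz hyz
    rw [← he, inf_idem, hC y hy] at h1
    have h2 : y ∈ P.verts := by rw [← h1]; simp [fiveWalk]
    simp [P] at h2
    have := (hA y hy).2.1
    have := (hxy y hy).ne
    have : y ≠ u := fun h => (hA y hy).2.2 (h ▸ hu)
    grind
  refine le_maxFive P Y C hinj ?_ hint
  intro y hy
  rw [hC y hy]
  exact fiveWalk_isFive _ _ _ _ _ hx.2.1.symm (hA y hy).2.1.symm
    (fun h => (hA y hy).2.2 (h ▸ hu)) (hwu y hy).symm (fun h => hx.2.2 (h ▸ hvw y hy))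

lemma bound_edge [Fintype V] {G : SimpleGraph V} (h4 : NoFourCycle G) {v u : V} {d : ℕ}
    (hu : G.Adj v u)
    (hedge : ((maxFiveCyclesInter G (G.subgraphOfAdj hu) : ℝ)) ≤ ((d : ℝ) - 2) / 2)
    (X : Finset V) (y w : V → V) (hX : ∀ x ∈ X, InA G v u x)
    (hxy : ∀ x ∈ X, G.Adj x (y x)) (hwu : ∀ x ∈ X, w x ≠ u) (hvw : ∀ x ∈ X, G.Adj v (w x))
    (hA : ∀ x ∈ X, InA G v (w x) (y x)) (hwinj : Set.InjOn w X) :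
    2 * X.card + 2 ≤ d := by
  classical
  set P : G.Subgraph := G.subgraphOfAdj hu with hPdef
  suffices h : X.card ≤ maxFiveCyclesInter G P by
    have : (X.card : ℝ) ≤ maxFiveCyclesInter G P := by exact_mod_cast h
    have : (2 * X.card + 2 : ℝ) ≤ d := by linarith
    exact_mod_cast this
  let C : V → G.Subgraph := fun x => if h : x ∈ X then
    (fiveWalk hu (hX x h).1 (hxy x h) (hA x h).1.symm (hvw x h).symm).toSubgraph else ⊥
  have hC : ∀ x (h : x ∈ X), C x =
    (fiveWalk hu (hX x h).1 (hxy x h) (hA x h).1.symm (hvw x h).symm).toSubgraph := by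
    intro y h; simp [C, h]
  have hint : ∀ x ∈ X, ∀ z ∈ X, x ≠ z → C x ⊓ C z = P := by
    intro x hx z hz hxz
    rw [hC x hx, hC z hz]
    have e1 : w x ≠ w z := fun h => hxz (hwinj hx hz h)
    have e2 : y x ≠ w z := fun h => (hA x hx).2.2 (h ▸ hvw z hz)
    have e3 : y z ≠ w x := fun h => (hA z hz).2.2 (h ▸ hvw x hx)
    have e4 : y x ≠ y z := fun h =>
      e1 (InA.unique h4 (hvw x hx) (hvw z hz) (hA x hx) (h ▸ hA z hz))
    have e5 : x ≠ y z := fun h =>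
      hwu z hz (InA.unique h4 (hvw z hz) hu (hA z hz) (h ▸ hX x hx))
    have e6 : z ≠ y x := fun h =>
      hwu x hx (InA.unique h4 (hvw x hx) hu (hA x hx) (h ▸ hX z hz))
    have := hu.ne; have := (hX x hx).1.ne; have := (hX x hx).2.1
    have := (hX z hz).1.ne; have := (hX z hz).2.1
    have := (hxy x hx).ne; have := (hxy z hz).ne
    have := (hA x hx).1.ne; have := (hA z hz).1.ne
    have := (hvw x hx).ne; have := (hvw z hz).ne
    have := (hA x hx).2.1; have := (hA z hz).2.1
    have := hwu x hx; have := hwu z hz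
    have : u ≠ y x := fun h => (hA x hx).2.2 (h ▸ hu)
    have : u ≠ y z := fun h => (hA z hz).2.2 (h ▸ hu)
    have : x ≠ w x := fun h => (hX x hx).2.2 (by rw [h]; exact hvw x hx)
    have : x ≠ w z := fun h => (hX x hx).2.2 (by rw [h]; exact hvw z hz)
    have : z ≠ w x := fun h => (hX z hz).2.2 (by rw [h]; exact hvw x hx)
    have : z ≠ w z := fun h => (hX z hz).2.2 (by rw [h]; exact hvw z hz)
    ext a b
    · simp [fiveWalk, P]
      grind
    · simp [fiveWalk, P]
      grind
  have hinj : Set.InjOn C X := by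
    intro x hx z hz he
    by_contra hxz
    have h1 := hint x hx z hz hxz
    rw [← he, inf_idem, hC x hx] at h1
    have h2 : x ∈ P.verts := by rw [← h1]; simp [fiveWalk]
    simp [P] at h2
    rcases h2 with h | h
    · exact (hX x hx).2.1 h
    · exact (hX x hx).1.ne h.symm
  refine le_maxFive P X C hinj ?_ hint
  intro x hx
  rw [hC x hx]
  exact fiveWalk_isFive _ _ _ _ _ (hX x hx).2.1.symm (hA x hx).2.1.symm
    (fun h => (hA x hx).2.2 (h ▸ hu)) (hwu x hx).symm
    (fun h => (hX x hx).2.2 (by rw [h]; exact hvw x hx))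

open Classical in
/-- The finset of vertices below `u`. -/
noncomputable def setA [Fintype V] (G : SimpleGraph V) (v u : V) : Finset V :=
  Finset.univ.filter (fun x => InA G v u x)

open Classical in
/-- The colors needed below `u`. -/
noncomputable def setL [Fintype V] (G : SimpleGraph V) (v u : V) : Finset V :=
  Finset.univ.filter (fun c => InA G u v c)

lemma mem_setA [Fintype V] {G : SimpleGraph V} {v u x : V} :
    x ∈ setA G v u ↔ InA G v u x := by
  simp [setA]

lemma card_setA [Fintype V] [DecidableEq V] {G : SimpleGraph V} [DecidableRel G.Adj] {d : ℕ}
    (hreg : G.IsRegularOfDegree d) (h4 : NoFourCycle G) {v u : V} (hu : G.Adj v u) :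
    d ≤ (setA G v u).card + 2 ∧
      (setA G v u).card + 1 + (G.neighborFinset u ∩ G.neighborFinset v).card = d := by
  have h1 : (G.neighborFinset u ∩ G.neighborFinset v).card ≤ 1 := by
    rw [Finset.card_le_one]
    intro a ha b hb
    simp at ha hb
    exact noFour_eq h4 ha.1 ha.2.symm hb.2 hb.1.symm hu.ne.symm
  have h2 : G.neighborFinset u =
      insert v (setA G v u ∪ (G.neighborFinset u ∩ G.neighborFinset v)) := by
    ext x
    simp only [mem_setA, InA, mem_neighborFinset, Finset.mem_insert, Finset.mem_union,
      Finset.mem_inter]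
    have := hu.symm
    grind
  have h3 : (G.neighborFinset u).card = d := by
    rw [card_neighborFinset_eq_degree]; exact hreg u
  have h5 : (G.neighborFinset u).card =
      (setA G v u).card + (G.neighborFinset u ∩ G.neighborFinset v).card + 1 := by
    conv_lhs => rw [h2]
    rw [Finset.card_insert_of_notMem, Finset.card_union_of_disjoint]
    · rw [Finset.disjoint_left]
      intro x hx hx'
      simp [mem_setA, InA] at hx hx'
      exact hx.2.2 hx'.2
    · simp [mem_setA, InA]
  omega

lemma setL_eq [Fintype V] (G : SimpleGraph V) (v u : V) : setL G v u = setA G u v := rfl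

/-- Inductive step data: the second level can be colored. -/
lemma color_level [Fintype V] {G : SimpleGraph V} [DecidableRel G.Adj] {d : ℕ}
    (hreg : G.IsRegularOfDegree d) (h4 : NoFourCycle G) (v : V)
    (hedge : ∀ u : V, ∀ h : G.Adj v u,
      ((maxFiveCyclesInter G (G.subgraphOfAdj h) : ℝ)) ≤ ((d : ℝ) - 2) / 2)
    (hpath : ∀ P : G.Subgraph, IsTwoPath G P →
      ((maxFiveCyclesInter G P : ℝ)) ≤ ((d : ℝ) - 2) / 2) (S : Finset V) :
    (∀ u ∈ S, G.Adj v u) → ∃ f : V → V,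
      (∀ u ∈ S, ∀ x, InA G v u x → InA G u v (f x)) ∧
      (∀ u ∈ S, ∀ x y, InA G v u x → InA G v u y → f x = f y → x = y) ∧
      (∀ u ∈ S, ∀ w ∈ S, ∀ x y, InA G v u x → InA G v w y → G.Adj x y → f x ≠ f y) := by
  classical
  induction S using Finset.induction_on with
  | empty => intro _; exact ⟨id, by simp⟩
  | insert u S huS ih =>
    intro hS
    have hu : G.Adj v u := hS u (by simp)
    have hS' : ∀ w ∈ S, G.Adj v w := fun w hw => hS w (by simp [hw])
    obtain ⟨f, f1, f2, f3⟩ := ih hS'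
    let B : V → Finset V := fun x =>
      Finset.univ.filter (fun y => G.Adj x y ∧ ∃ w ∈ S, InA G v w y)
    let allowed : {x // InA G v u x} → Finset V := fun x => setL G v u \ (B x).image f
    obtain ⟨c1, c2⟩ := card_setA hreg h4 hu
    obtain ⟨c3, c4⟩ := card_setA hreg h4 hu.symm
    rw [Finset.inter_comm] at c4
    have hcard : (setA G v u).card = (setL G v u).card := by
      rw [setL_eq]; omega
    have hall : ∀ T : Finset {x // InA G v u x}, T.card ≤ (T.biUnion allowed).card := by
      intro T
      by_contra hlt
      push Not at hlt
      have hTn : T.card ≤ (setA G v u).card := by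
        rw [← Finset.card_map (Function.Embedding.subtype _)]
        apply Finset.card_le_card
        intro x hx
        simp at hx
        obtain ⟨h, -⟩ := hx
        simp [setA, h]
      obtain ⟨x0, hx0⟩ : T.Nonempty := by
        rw [← Finset.card_pos]; omega
      have b1 : 2 * (B x0).card + 2 ≤ d := by
        apply bound_path h4 hpath hu x0.2
        intro y hy
        simp only [B, Finset.mem_filter, Finset.mem_univ, true_and] at hy
        obtain ⟨hy1, w, hw, hy2⟩ := hy
        exact ⟨hy1, w, fun h => huS (h ▸ hw), hS' w hw, hy2⟩
      have b2 : (setL G v u).card ≤ (T.biUnion allowed).card + (B x0).card := by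
        have q1 : (allowed x0).card ≤ (T.biUnion allowed).card :=
          Finset.card_le_card (Finset.subset_biUnion_of_mem allowed hx0)
        have q2 := Finset.le_card_sdiff ((B x0).image f) (setL G v u)
        have q3 : ((B x0).image f).card ≤ (B x0).card := Finset.card_image_le
        have q4 : (allowed x0).card = (setL G v u \ (B x0).image f).card := rfl
        omega
      obtain ⟨c, hcL, hcN⟩ : ∃ c ∈ setL G v u, c ∉ T.biUnion allowed := by
        by_contra hcon
        push Not at hcon
        have := Finset.card_le_card (show setL G v u ⊆ T.biUnion allowed from hcon)
        omega
      have hforb : ∀ x ∈ T.map (Function.Embedding.subtype _), ∃ y w, InA G v u x ∧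
          G.Adj x y ∧ w ∈ S ∧ InA G v w y ∧ f y = c := by
        intro x hx
        simp only [Finset.mem_map, Function.Embedding.subtype_apply] at hx
        obtain ⟨x, hx, rfl⟩ := hx
        have : c ∉ allowed x := fun h => hcN (Finset.mem_biUnion.2 ⟨x, hx, h⟩)
        simp only [allowed, Finset.mem_sdiff, hcL, true_and, not_not, Finset.mem_image, B,
          Finset.mem_filter, Finset.mem_univ] at this
        obtain ⟨y, ⟨h1, w, hw, h2⟩, h3⟩ := this
        exact ⟨y, w, x.2, h1, hw, h2, h3⟩
      choose! y w g1 g2 g3 g4 g5 using hforb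
      have b3 := bound_edge h4 hu (hedge u hu) (T.map (Function.Embedding.subtype _)) y w g1 g2
        (fun x hx h => huS (h ▸ g3 x hx)) (fun x hx => hS' _ (g3 x hx)) g4 (by
          intro x hx z hz he
          have hyy : y x = y z := f2 (w x) (g3 x hx) _ _ (g4 x hx) (he ▸ g4 z hz)
            ((g5 x hx).trans (g5 z hz).symm)
          refine noFour_eq h4 (g1 x hx).1 (g2 x hx) (hyy ▸ (g2 z hz).symm) (g1 z hz).1.symm ?_
          intro h
          exact (g4 x hx).2.2 (h ▸ hu))
      rw [Finset.card_map] at b3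
      omega
    obtain ⟨g, ginj, gmem⟩ := (Finset.all_card_le_biUnion_card_iff_exists_injective allowed).1 hall
    have gL : ∀ x, InA G u v (g x) := by
      intro x
      have := gmem x
      simp only [allowed, Finset.mem_sdiff, setL, Finset.mem_filter] at this
      exact this.1.2
    have gB : ∀ x : {x // InA G v u x}, ∀ w ∈ S, ∀ y, InA G v w y → G.Adj x y → g x ≠ f y := by
      intro x w hw y hy hxy he
      have := gmem x
      simp only [allowed, Finset.mem_sdiff, Finset.mem_image, B] at this
      exact this.2 ⟨y, by simp only [Finset.mem_filter, Finset.mem_univ, true_and]; exact ⟨hxy, w, hw, hy⟩, he.symm⟩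
    let f' : V → V := fun x => if h : InA G v u x then g ⟨x, h⟩ else f x
    have e1 : ∀ x (h : InA G v u x), f' x = g ⟨x, h⟩ := fun x h => by simp [f', h]
    have e2 : ∀ w ∈ S, ∀ x, InA G v w x → f' x = f x := by
      intro w hw x hx
      have : ¬ InA G v u x := fun h => huS ((InA.unique h4 hu (hS' w hw) h hx) ▸ hw)
      simp [f', this]
    refine ⟨f', ?_, ?_, ?_⟩
    · intro w hw x hx
      rcases Finset.mem_insert.1 hw with rfl | hw
      · rw [e1 x hx]; exact gL _
      · rw [e2 w hw x hx]; exact f1 w hw x hx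
    · intro w hw x y hx hy he
      rcases Finset.mem_insert.1 hw with rfl | hw
      · rw [e1 x hx, e1 y hy] at he
        simpa using ginj he
      · rw [e2 w hw x hx, e2 w hw y hy] at he
        exact f2 w hw x y hx hy he
    · intro w hw z hz x y hx hy hxy
      rcases Finset.mem_insert.1 hw with rfl | hw2 <;> rcases Finset.mem_insert.1 hz with rfl | hz2
      · rw [e1 x hx, e1 y hy]
        intro he
        have := ginj he
        simp at this
        exact hxy.ne this
      · rw [e1 x hx, e2 z hz2 y hy]
        exact gB ⟨x, hx⟩ z hz2 y hy hxy
      · rw [e1 y hy, e2 w hw2 x hx]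
        exact (gB ⟨y, hy⟩ w hw2 x hx hxy.symm).symm
      · rw [e2 w hw2 x hx, e2 z hz2 y hy]
        exact f3 w hw2 z hz2 x y hx hy hxy

/-- Greedy extension of a partial proper coloring. -/
lemma greedy [Fintype V] {G : SimpleGraph V} [DecidableRel G.Adj] {d : ℕ}
    (hreg : G.IsRegularOfDegree d) (K : Finset V) (hK : K.card = d + 1) (D : V → Prop)
    (f : V → V) (hfK : ∀ x, D x → f x ∈ K) (hf : ∀ x y, D x → D y → G.Adj x y → f x ≠ f y)
    (T : Finset V) : ∃ F : V → V, (∀ x, D x → F x = f x) ∧ (∀ x, D x ∨ x ∈ T → F x ∈ K) ∧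
      ∀ x y, (D x ∨ x ∈ T) → (D y ∨ y ∈ T) → G.Adj x y → F x ≠ F y := by
  classical
  induction T using Finset.induction_on with
  | empty => exact ⟨f, by simp, by simpa using hfK, by simpa using hf⟩
  | insert a T haT ih =>
    obtain ⟨F, F1, F2, F3⟩ := ih
    by_cases hDa : D a
    · refine ⟨F, F1, ?_, ?_⟩
      · intro x hx
        apply F2
        grind
      · intro x y hx hy
        apply F3 <;> grind
    · obtain ⟨c, hcK, hc⟩ : ∃ c ∈ K, c ∉ (G.neighborFinset a).image F := by
        by_contra hcon
        push Not at hcon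
        have q1 := Finset.card_le_card (show K ⊆ (G.neighborFinset a).image F from hcon)
        have q2 : ((G.neighborFinset a).image F).card ≤ (G.neighborFinset a).card :=
          Finset.card_image_le
        rw [card_neighborFinset_eq_degree, hreg a] at q2
        omega
      have hc' : ∀ y, G.Adj a y → F y ≠ c := by
        intro y hy he
        exact hc (Finset.mem_image.2 ⟨y, by simpa using hy, he⟩)
      refine ⟨Function.update F a c, ?_, ?_, ?_⟩
      · intro x hx
        rw [Function.update_of_ne (by rintro rfl; exact hDa hx)]
        exact F1 x hx
      · intro x hx
        by_cases hxa : x = a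
        · subst hxa; simpa using hcK
        · rw [Function.update_of_ne hxa]
          apply F2
          grind
      · intro x y hx hy hxy
        by_cases hxa : x = a
        · subst hxa
          rw [Function.update_self, Function.update_of_ne hxy.ne.symm]
          exact (hc' y hxy).symm
        · by_cases hya : y = a
          · subst hya
            rw [Function.update_self, Function.update_of_ne hxa]
            exact hc' x hxy.symm
          · rw [Function.update_of_ne hxa, Function.update_of_ne hya]
            apply F3 x y _ _ hxy <;> grind

lemma bColoring_le [Fintype V] {G : SimpleGraph V} [DecidableRel G.Adj] {d : ℕ}
    (hreg : G.IsRegularOfDegree d) {k : ℕ} {C : V → Fin k} (hC : IsBColoring G k C) :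
    k ≤ d + 1 := by
  classical
  rcases k with _ | k
  · omega
  obtain ⟨v, hv, hdom⟩ := hC.2 0
  have h1 : (Finset.univ.erase (0 : Fin (k+1))) ⊆ (G.neighborFinset v).image C := by
    intro c hc
    obtain ⟨u, hu, rfl⟩ := hdom c (by simpa using hc)
    exact Finset.mem_image.2 ⟨u, by simpa using hu, rfl⟩
  have h2 := Finset.card_le_card h1
  have h3 : ((G.neighborFinset v).image C).card ≤ (G.neighborFinset v).card :=
    Finset.card_image_le
  rw [card_neighborFinset_eq_degree, hreg v] at h3
  rw [Finset.card_erase_of_mem (Finset.mem_univ _), Finset.card_univ, Fintype.card_fin] at h2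
  omega

end Aux

/-- If `G` is `d`-regular with no 4-cycle, some vertex `v` satisfies `max_{u,v} ≤ (d-2)/2`
for every edge `{u,v}` at `v`, and `max_P ≤ (d-2)/2` for every path `P` of length two,
then `φ(G) = d + 1`. -/
theorem bChromatic_eq_of_maxInter_le
    {V : Type*} [Fintype V] (G : SimpleGraph V) [DecidableRel G.Adj] (d : ℕ)
    (hreg : G.IsRegularOfDegree d) (h4 : NoFourCycle G)
    (v : V)
    (hedge : ∀ u : V, ∀ h : G.Adj v u,
      ((maxFiveCyclesInter G (G.subgraphOfAdj h) : ℝ)) ≤ ((d : ℝ) - 2) / 2)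
    (hpath : ∀ P : G.Subgraph, IsTwoPath G P →
      ((maxFiveCyclesInter G P : ℝ)) ≤ ((d : ℝ) - 2) / 2) :
    bChromaticNumber G = d + 1 := by
  classical
  have hup : ∀ k ∈ {k : ℕ | ∃ C : V → Fin k, IsBColoring G k C}, k ≤ d + 1 := by
    rintro k ⟨C, hC⟩
    exact bColoring_le hreg hC
  suffices hex : d + 1 ∈ {k : ℕ | ∃ C : V → Fin k, IsBColoring G k C} from
    le_antisymm (csSup_le ⟨_, hex⟩ hup) (le_csSup ⟨_, hup⟩ hex)
  obtain ⟨f, f1, f2, f3⟩ := color_level hreg h4 v hedge hpath (G.neighborFinset v) (by simp)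
  simp only [mem_neighborFinset] at f1 f2 f3
  let K : Finset V := insert v (G.neighborFinset v)
  have hK : K.card = d + 1 := by
    rw [Finset.card_insert_of_notMem (by simp), card_neighborFinset_eq_degree, hreg v]
  have memK : ∀ x, x ∈ K ↔ x = v ∨ G.Adj v x := by intro x; simp [K]
  let f0 : V → V := fun x => if x ∈ K then x else f x
  have f0K : ∀ x ∈ K, f0 x = x := fun x hx => by simp [f0, hx]
  have f0A : ∀ u x, InA G v u x → f0 x = f x := by
    intro u x hx
    have : x ∉ K := by rw [memK]; rintro (h | h); exacts [hx.2.1 h, hx.2.2 h]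
    simp [f0, this]
  have key : ∀ u x, G.Adj v u → InA G v u x → ∀ y ∈ K, G.Adj x y → f x ≠ y := by
    intro u x hu hx y hy hxy he
    have hL := f1 u hu x hx
    rcases (memK y).1 hy with rfl | hy
    · exact hx.2.2 hxy.symm
    · have : u = y := noFour_eq h4 hu hx.1 hxy hy.symm hx.2.1.symm
      exact hL.2.1 (he.trans this.symm)
  obtain ⟨F, F1, F2, F3⟩ := greedy hreg K hK (fun x => x ∈ K ∨ ∃ u, G.Adj v u ∧ InA G v u x) f0
    (by
      rintro x (hx | ⟨u, hu, hx⟩)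
      · rw [f0K x hx]; exact hx
      · rw [f0A u x hx, memK]
        exact Or.inr (f1 u hu x hx).1)
    (by
      rintro x y (hx | ⟨u, hu, hx⟩) (hy | ⟨w, hw, hy⟩) hxy
      · rw [f0K x hx, f0K y hy]; exact hxy.ne
      · rw [f0K x hx, f0A w y hy]; exact (key w y hw hy x hx hxy.symm).symm
      · rw [f0A u x hx, f0K y hy]; exact key u x hu hx y hy hxy
      · rw [f0A u x hx, f0A w y hy]; exact f3 u hu w hw x y hx hy hxy) Finset.univ
  simp only [Finset.mem_univ, or_true, forall_const] at F2 F3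
  have FK : ∀ x ∈ K, F x = x := fun x hx => (F1 x (Or.inl hx)).trans (f0K x hx)
  have hsurj : ∀ u, G.Adj v u → ∀ c, InA G u v c → ∃ x, G.Adj u x ∧ F x = c := by
    intro u hu c hc
    obtain ⟨-, c2⟩ := card_setA hreg h4 hu
    obtain ⟨-, c4⟩ := card_setA hreg h4 hu.symm
    rw [Finset.inter_comm] at c4
    have himg : (setA G v u).image f = setA G u v := by
      apply Finset.eq_of_subset_of_card_le
      · intro z hz
        obtain ⟨x, hx, rfl⟩ := Finset.mem_image.1 hz
        simp only [setA, Finset.mem_filter, Finset.mem_univ, true_and] at hx ⊢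
        exact f1 u hu x hx
      · rw [Finset.card_image_of_injOn]
        · omega
        · intro x hx y hy he
          simp only [setA, Finset.coe_filter, Finset.mem_univ, true_and, Set.mem_ofPred_eq] at hx hy
          exact f2 u hu x y hx hy he
    have : c ∈ (setA G v u).image f := by rw [himg]; simp [setA, hc]
    obtain ⟨x, hx, rfl⟩ := Finset.mem_image.1 this
    simp only [setA, Finset.mem_filter, Finset.mem_univ, true_and] at hx
    exact ⟨x, hx.1, (F1 x (Or.inr ⟨u, hu, hx⟩)).trans (f0A u x hx)⟩
  let e : K ≃ Fin (d + 1) := K.equivFinOfCardEq hK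
  refine ⟨fun x => e ⟨F x, F2 x⟩, ?_, ?_⟩
  · intro x y hxy he
    have := e.injective he
    simp only [Subtype.mk.injEq] at this
    exact F3 x y hxy this
  · intro c
    obtain ⟨⟨u, hu⟩, rfl⟩ := e.surjective c
    refine ⟨u, by simp [FK u hu], ?_⟩
    intro c' hc'
    obtain ⟨⟨w, hw⟩, rfl⟩ := e.surjective c'
    have hwu : w ≠ u := by rintro rfl; exact hc' rfl
    suffices h : ∃ x, G.Adj u x ∧ F x = w by
      obtain ⟨x, hx, hxw⟩ := h
      exact ⟨x, hx, by simp [hxw]⟩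
    rcases (memK u).1 hu with rfl | hu'
    · rcases (memK w).1 hw with rfl | hw'
      · exact absurd rfl hwu
      · exact ⟨w, hw', FK w hw⟩
    · by_cases hadj : G.Adj u w
      · exact ⟨w, hadj, FK w hw⟩
      · rcases (memK w).1 hw with rfl | hw'
        · exact absurd hu'.symm hadj
        · exact hsurj u hu' w ⟨hw', hwu, hadj⟩
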